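/- Let φ, ψ : K → L and φ', ψ' : K' → L' be simplicial maps and fix an integer m ≥ 1. Then SD_m(φ × φ', ψ × ψ') + 1 ≤ (SD_m(φ, ψ) + 1) · (SD_m(φ', ψ') + 1), where φ × φ', ψ × ψ' : K × K' → L × L' are the product maps between categorical products. -/

import Mathlib

noncomputable section
open scoped Classical

/-- An abstract simplicial complex on vertex type `V`: a collection of nonempty
finite subsets (simplices) closed under passing to nonempty subsets. -/
structure SComplex (V : Type) where
  faces : Set (Finset V)
  nonempty_of_mem : ∀ σ ∈ faces, σ.Nonempty
  down_closed : ∀ σ ∈ faces, ∀ τ ⊆ σ, τ.Nonempty → τ ∈ faces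

namespace SComplex

/-- `f` is a simplicial map from `K` to `L`. -/
def IsSimplicialMap {V W : Type} (K : SComplex V) (L : SComplex W) (f : V → W) : Prop :=
  ∀ σ ∈ K.faces, σ.image f ∈ L.faces

/-- `f` and `g` are contiguous as maps from `K` to `L`. -/
def Contiguous {V W : Type} (K : SComplex V) (L : SComplex W) (f g : V → W) : Prop :=
  ∀ σ ∈ K.faces, σ.image f ∪ σ.image g ∈ L.faces

/-- `f` and `g` are in the same contiguity class: there is a finite chain of
simplicial maps from `f` to `g` in which consecutive maps are contiguous. -/
def SameClass {V W : Type} (K : SComplex V) (L : SComplex W) (f g : V → W) : Prop :=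
  Relation.ReflTransGen
    (fun a b => K.IsSimplicialMap L a ∧ K.IsSimplicialMap L b ∧ K.Contiguous L a b) f g

/-- `K'` is a subcomplex of `K`. -/
def IsSubcomplex {V : Type} (K' K : SComplex V) : Prop :=
  K'.faces ⊆ K.faces

/-- `Ks` is a covering of `K` by subcomplexes. -/
def Covers {V : Type} (K : SComplex V) {k : ℕ} (Ks : Fin (k + 1) → SComplex V) : Prop :=
  (∀ j, (Ks j).IsSubcomplex K) ∧ ∀ σ ∈ K.faces, ∃ j, σ ∈ (Ks j).faces

/-- `P` has dimension at most `m`. -/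
def DimLE {U : Type} (P : SComplex U) (m : ℕ) : Prop :=
  ∀ σ ∈ P.faces, σ.card ≤ m + 1

/-- The `m`-contiguity distance `SD_m(φ, ψ)`. -/
noncomputable def SDm {V W : Type} (m : ℕ) (K : SComplex V) (L : SComplex W)
    (φ ψ : V → W) : ℕ∞ :=
  sInf {n : ℕ∞ | ∃ k : ℕ, n = (k : ℕ∞) ∧ ∃ Ks : Fin (k + 1) → SComplex V, K.Covers Ks ∧
    ∀ j, ∀ (P : Type) (PC : SComplex P), PC.DimLE m →
      ∀ η : P → V, PC.IsSimplicialMap (Ks j) η → PC.SameClass L (φ ∘ η) (ψ ∘ η)}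

/-- The contiguity distance `SD(φ, ψ)`. -/
noncomputable def SD {V W : Type} (K : SComplex V) (L : SComplex W) (φ ψ : V → W) : ℕ∞ :=
  sInf {n : ℕ∞ | ∃ k : ℕ, n = (k : ℕ∞) ∧ ∃ Ks : Fin (k + 1) → SComplex V, K.Covers Ks ∧
    ∀ j, (Ks j).SameClass L φ ψ}

/-- The `m`-simplicial Lusternik–Schnirelmann category `scat_m(K)`. -/
noncomputable def scatm {V : Type} (m : ℕ) (K : SComplex V) : ℕ∞ :=
  sInf {n : ℕ∞ | ∃ k : ℕ, n = (k : ℕ∞) ∧ ∃ Ks : Fin (k + 1) → SComplex V, K.Covers Ks ∧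
    ∀ j, ∀ (P : Type) (PC : SComplex P), PC.DimLE m →
      ∀ η : P → V, PC.IsSimplicialMap (Ks j) η →
        ∃ v0 : V, PC.SameClass K η (fun _ => v0)}

/-- The simplicial Lusternik–Schnirelmann category `scat(K)`. -/
noncomputable def scat {V : Type} (K : SComplex V) : ℕ∞ :=
  sInf {n : ℕ∞ | ∃ k : ℕ, n = (k : ℕ∞) ∧ ∃ Ks : Fin (k + 1) → SComplex V, K.Covers Ks ∧
    ∀ j, ∃ v0 : V, (Ks j).SameClass K id (fun _ => v0)}

/-- The categorical product of two simplicial complexes. -/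
def prod {V W : Type} (K : SComplex V) (L : SComplex W) : SComplex (V × W) where
  faces := {σ | σ.Nonempty ∧ σ.image Prod.fst ∈ K.faces ∧ σ.image Prod.snd ∈ L.faces}
  nonempty_of_mem := fun _ h => h.1
  down_closed := by
    rintro σ ⟨-, h1, h2⟩ τ hτσ hτ
    exact ⟨hτ, K.down_closed _ h1 _ (Finset.image_subset_image hτσ) (hτ.image _),
      L.down_closed _ h2 _ (Finset.image_subset_image hτσ) (hτ.image _)⟩

/-- The barycentric subdivision: vertices are the simplices of `K`, simplices are
the chains of simplices of `K` (totally ordered by inclusion). -/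
def sd {V : Type} (K : SComplex V) : SComplex (Finset V) where
  faces := {S | S.Nonempty ∧ (∀ σ ∈ S, σ ∈ K.faces) ∧ ∀ σ ∈ S, ∀ τ ∈ S, σ ⊆ τ ∨ τ ⊆ σ}
  nonempty_of_mem := fun _ h => h.1
  down_closed := by
    rintro S ⟨-, h1, h2⟩ T hTS hT
    exact ⟨hT, fun σ hσ => h1 σ (hTS hσ), fun σ hσ τ hτ => h2 σ (hTS hσ) τ (hTS hτ)⟩

/-- The map induced on barycentric subdivisions: `sd(f)(σ) = f(σ)`. -/
def sdMap {V W : Type} (f : V → W) : Finset V → Finset W :=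
  fun σ => σ.image f

/-- The `m`-dimensional simplicial Švarc genus `secat_m(φ)`. -/
noncomputable def secatm {V W : Type} (m : ℕ) (K : SComplex V) (L : SComplex W)
    (φ : V → W) : ℕ∞ :=
  sInf {n : ℕ∞ | ∃ k : ℕ, n = (k : ℕ∞) ∧ ∃ Ls : Fin (k + 1) → SComplex W, L.Covers Ls ∧
    ∀ j, ∀ (P : Type) (PC : SComplex P), PC.DimLE m →
      ∀ η : P → W, PC.IsSimplicialMap (Ls j) η →
        ∃ s : P → V, PC.IsSimplicialMap K s ∧ φ ∘ s = η}

/-- The `m`-dimensional homotopy simplicial Švarc genus `hsecat_m(φ)`. -/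
noncomputable def hsecatm {V W : Type} (m : ℕ) (K : SComplex V) (L : SComplex W)
    (φ : V → W) : ℕ∞ :=
  sInf {n : ℕ∞ | ∃ k : ℕ, n = (k : ℕ∞) ∧ ∃ Ls : Fin (k + 1) → SComplex W, L.Covers Ls ∧
    ∀ j, ∀ (P : Type) (PC : SComplex P), PC.DimLE m →
      ∀ η : P → W, PC.IsSimplicialMap (Ls j) η →
        ∃ s : P → V, PC.IsSimplicialMap K s ∧ PC.SameClass L (φ ∘ s) η}

/-- The `m`-simplicial LS category `scat_m(φ)` of a simplicial map `φ : K → L`. -/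
noncomputable def scatmMap {V W : Type} (m : ℕ) (K : SComplex V) (L : SComplex W)
    (φ : V → W) : ℕ∞ :=
  sInf {n : ℕ∞ | ∃ k : ℕ, n = (k : ℕ∞) ∧ ∃ Ks : Fin (k + 1) → SComplex V, K.Covers Ks ∧
    ∀ j, ∀ (P : Type) (PC : SComplex P), PC.DimLE m →
      ∀ η : P → V, PC.IsSimplicialMap (Ks j) η →
        ∃ w0 : W, PC.SameClass L (φ ∘ η) (fun _ => w0)}

/-- `p : E → B` is a simplicial fibration. -/
def IsFibration {Ve Vb : Type} (E : SComplex Ve) (B : SComplex Vb) (p : Ve → Vb) : Prop :=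
  ∀ (X : Type) (KC : SComplex X) (ℓ : ℕ) (φs : Fin (ℓ + 1) → X → Vb),
    (∀ i, KC.IsSimplicialMap B (φs i)) →
    (∀ i : Fin ℓ, KC.Contiguous B (φs i.castSucc) (φs i.succ)) →
    ∀ φt : X → Ve, KC.IsSimplicialMap E φt → p ∘ φt = φs 0 →
      ∃ φts : Fin (ℓ + 1) → X → Ve, φts 0 = φt ∧
        (∀ i, KC.IsSimplicialMap E (φts i)) ∧
        (∀ i : Fin ℓ, KC.Contiguous E (φts i.castSucc) (φts i.succ)) ∧
        ∀ i, p ∘ φts i = φs i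

/-- `β : K → M` is a strong equivalence. -/
def IsStrongEquivalence {V U : Type} (K : SComplex V) (M : SComplex U) (β : V → U) : Prop :=
  K.IsSimplicialMap M β ∧ ∃ δ : U → V, M.IsSimplicialMap K δ ∧
    K.SameClass K (δ ∘ β) id ∧ M.SameClass M (β ∘ δ) id

/-- The diagonal map `Δ : V → V × V`. -/
def diag (V : Type) : V → V × V := fun v => (v, v)

/-- The `m`-discrete topological complexity `TC^m(K)`. -/
noncomputable def TCm {V : Type} (m : ℕ) (K : SComplex V) : ℕ∞ :=
  sInf {n : ℕ∞ | ∃ k : ℕ, n = (k : ℕ∞) ∧ ∃ Ωs : Fin (k + 1) → SComplex (V × V),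
    (K.prod K).Covers Ωs ∧
    ∀ j, ∃ σj : V × V → V, (Ωs j).IsSimplicialMap K σj ∧
      ∀ (P : Type) (PC : SComplex P), PC.DimLE m →
        ∀ η : P → V × V, PC.IsSimplicialMap (Ωs j) η →
          PC.SameClass (K.prod K) (diag V ∘ σj ∘ η) η}

/-- The discrete topological complexity `TC(K)`. -/
noncomputable def TC {V : Type} (K : SComplex V) : ℕ∞ :=
  sInf {n : ℕ∞ | ∃ k : ℕ, n = (k : ℕ∞) ∧ ∃ Ωs : Fin (k + 1) → SComplex (V × V),
    (K.prod K).Covers Ωs ∧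
    ∀ j, ∃ σj : V × V → V, (Ωs j).IsSimplicialMap K σj ∧
      (Ωs j).SameClass (K.prod K) (diag V ∘ σj) id}

end SComplex

open SComplex

namespace SComplex

theorem isSimplicialMap_iff_contiguous_self {U V : Type} {P : SComplex U} {K : SComplex V}
    {f : U → V} : P.IsSimplicialMap K f ↔ P.Contiguous K f f := by
  simp [IsSimplicialMap, Contiguous]

theorem IsSimplicialMap.comp {U V W : Type} {P : SComplex U} {K : SComplex V} {L : SComplex W}
    {g : V → W} {f : U → V} (hg : K.IsSimplicialMap L g) (hf : P.IsSimplicialMap K f) :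
    P.IsSimplicialMap L (g ∘ f) := fun σ hσ => by
  simpa [Finset.image_image] using hg _ (hf σ hσ)

theorem IsSimplicialMap.mono {U V : Type} {P : SComplex U} {K' K : SComplex V} {f : U → V}
    (hf : P.IsSimplicialMap K' f) (h : K'.IsSubcomplex K) : P.IsSimplicialMap K f :=
  fun σ hσ => h (hf σ hσ)

/-- Two maps into a categorical product are contiguous iff their coordinates are. -/
theorem contiguous_prod_iff {U V W : Type} {P : SComplex U} {K : SComplex V} {L : SComplex W}
    {f g : U → V × W} :
    P.Contiguous (K.prod L) f g ↔
      P.Contiguous K (Prod.fst ∘ f) (Prod.fst ∘ g) ∧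
        P.Contiguous L (Prod.snd ∘ f) (Prod.snd ∘ g) := by
  simp only [Contiguous, prod, Set.mem_ofPred_eq, Finset.image_union, Finset.image_image]
  exact ⟨fun h => ⟨fun σ hσ => (h σ hσ).2.1, fun σ hσ => (h σ hσ).2.2⟩,
    fun h σ hσ => ⟨by simp [P.nonempty_of_mem σ hσ], h.1 σ hσ, h.2 σ hσ⟩⟩

theorem isSimplicialMap_prod_iff {U V W : Type} {P : SComplex U} {K : SComplex V}
    {L : SComplex W} {f : U → V × W} :
    P.IsSimplicialMap (K.prod L) f ↔
      P.IsSimplicialMap K (Prod.fst ∘ f) ∧ P.IsSimplicialMap L (Prod.snd ∘ f) := by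
  simp only [isSimplicialMap_iff_contiguous_self, contiguous_prod_iff]

/-- Contiguity classes are compatible with pairing of maps. -/
theorem SameClass.prodMk {U V W : Type} {P : SComplex U} {K : SComplex V} {L : SComplex W}
    {a b : U → V} {c d : U → W} (hab : P.SameClass K a b) (hcd : P.SameClass L c d)
    (hb : P.IsSimplicialMap K b) (hc : P.IsSimplicialMap L c) :
    P.SameClass (K.prod L) (fun u => (a u, c u)) (fun u => (b u, d u)) := by
  refine Relation.ReflTransGen.trans (b := fun u => (b u, c u)) ?_ ?_
  · exact Relation.ReflTransGen.lift (fun (x : U → V) u => (x u, c u))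
      (fun x y ⟨hx, hy, hxy⟩ => ⟨isSimplicialMap_prod_iff.2 ⟨hx, hc⟩,
        isSimplicialMap_prod_iff.2 ⟨hy, hc⟩,
        contiguous_prod_iff.2 ⟨hxy, isSimplicialMap_iff_contiguous_self.1 hc⟩⟩) _ _ hab
  · exact Relation.ReflTransGen.lift (fun (x : U → W) u => (b u, x u))
      (fun x y ⟨hx, hy, hxy⟩ => ⟨isSimplicialMap_prod_iff.2 ⟨hb, hx⟩,
        isSimplicialMap_prod_iff.2 ⟨hb, hy⟩,
        contiguous_prod_iff.2 ⟨isSimplicialMap_iff_contiguous_self.1 hb, hxy⟩⟩) _ _ hcd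

/-- A finite `m`-contiguity distance is attained by some covering. -/
theorem exists_covers_of_SDm_ne_top {V W : Type} {m : ℕ} {K : SComplex V} {L : SComplex W}
    {φ ψ : V → W} (h : SDm m K L φ ψ ≠ ⊤) :
    ∃ k : ℕ, SDm m K L φ ψ = k ∧ ∃ Ks : Fin (k + 1) → SComplex V, K.Covers Ks ∧
      ∀ j, ∀ (P : Type) (PC : SComplex P), PC.DimLE m →
        ∀ η : P → V, PC.IsSimplicialMap (Ks j) η → PC.SameClass L (φ ∘ η) (ψ ∘ η) := by
  have mem_of_ne_top (S : Set ℕ∞) (hS : sInf S ≠ ⊤) : sInf S ∈ S :=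
    csInf_mem (Set.nonempty_iff_ne_empty.2 fun he => hS (by rw [he, sInf_empty]))
  exact mem_of_ne_top _ h

end SComplex

/-- the product inequality
`SD_m(φ × φ', ψ × ψ') + 1 ≤ (SD_m(φ, ψ) + 1) · (SD_m(φ', ψ') + 1)`. -/
theorem SDm_prod_le {V W V' W' : Type} (K : SComplex V) (L : SComplex W)
    (K' : SComplex V') (L' : SComplex W')
    (φ ψ : V → W) (φ' ψ' : V' → W')
    (hφ : K.IsSimplicialMap L φ) (hψ : K.IsSimplicialMap L ψ)
    (hφ' : K'.IsSimplicialMap L' φ') (hψ' : K'.IsSimplicialMap L' ψ')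
    (m : ℕ) (hm : 1 ≤ m) :
    SDm m (K.prod K') (L.prod L') (Prod.map φ φ') (Prod.map ψ ψ') + 1 ≤
      (SDm m K L φ ψ + 1) * (SDm m K' L' φ' ψ' + 1) := by
  by_cases h : SDm m K L φ ψ = ⊤
  · simp [h]
  by_cases h' : SDm m K' L' φ' ψ' = ⊤
  · simp [h']
  obtain ⟨k, hk, Ks, ⟨hsub, hcov⟩, hKs⟩ := exists_covers_of_SDm_ne_top h
  obtain ⟨k', hk', Ks', ⟨hsub', hcov'⟩, hKs'⟩ := exists_covers_of_SDm_ne_top h'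
  have hcard : (k + 1) * (k' + 1) = k * k' + k + k' + 1 := by ring
  let e : Fin (k + 1) × Fin (k' + 1) ≃ Fin (k * k' + k + k' + 1) :=
    finProdFinEquiv.trans (finCongr hcard)
  have key : SDm m (K.prod K') (L.prod L') (Prod.map φ φ') (Prod.map ψ ψ') ≤
      ((k * k' + k + k' : ℕ) : ℕ∞) := by
    refine sInf_le ⟨_, rfl, fun i => (Ks (e.symm i).1).prod (Ks' (e.symm i).2), ⟨?_, ?_⟩, ?_⟩
    · exact fun i σ hσ => ⟨hσ.1, hsub _ hσ.2.1, hsub' _ hσ.2.2⟩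
    · rintro σ ⟨hσ, h₁, h₂⟩
      obtain ⟨j, hj⟩ := hcov _ h₁
      obtain ⟨j', hj'⟩ := hcov' _ h₂
      refine ⟨e (j, j'), ?_⟩
      simp only [e.symm_apply_apply]
      exact ⟨hσ, hj, hj'⟩
    · intro i P PC hP η hη
      obtain ⟨h₁, h₂⟩ := isSimplicialMap_prod_iff.1 hη
      exact (hKs _ P PC hP _ h₁).prodMk (hKs' _ P PC hP _ h₂)
        (hψ.comp (h₁.mono (hsub _))) (hφ'.comp (h₂.mono (hsub' _)))
  rw [hk, hk']
  refine (add_le_add_left key 1).trans (le_of_eq ?_)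
  exact_mod_cast hcard.symm
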